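/- Let b be in the closed unit ball of H^∞, E = {ζ ∈ 𝕋 : |b(ζ)| < 1}, and K = {(bh, √(1 − |b|²) h) : h ∈ H²} ⊂ H² ⊕ L²(E). For λ ∈ D define f_λ(ζ) = (1 − conj(b(λ)) b(ζ)) / (1 − conj(λ) ζ) ∈ H² and g_λ(ζ) = − conj(b(λ)) √(1 − |b(ζ)|²) / (1 − conj(λ) ζ) ∈ L²(E). Then (f_λ, g_λ) belongs to K^⊥, and for every (f, g) ∈ K^⊥ one has ⟨(f, g), (f_λ, g_λ)⟩_{H² ⊕ L²(E)} = F(λ), where F is the analytic extension of f to D. In other words, P₁(K^⊥) is a reproducing kernel Hilbert space of analytic functions on D whose kernel is the de Branges–Rovnyak kernel k_b(z, λ) = (1 − conj(b(λ)) b(z)) / (1 − conj(λ) z). -/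

import Mathlib

/-!
Statement 6: For `b` in the closed unit ball of `H^∞`,
`E = {ζ : |b(ζ)| < 1}`, `K = {(b h, √(1-|b|²) h) : h ∈ H²}` and `λ ∈ D`, the
pair `(f_λ, g_λ)` with
`f_λ(ζ) = (1 - conj(b(λ)) b(ζ))/(1 - conj(λ) ζ)`,
`g_λ(ζ) = - conj(b(λ)) √(1-|b(ζ)|²)/(1 - conj(λ) ζ)`
belongs to `K^⊥` (inside `H² ⊕ L²(E)`), and for every `(f, g) ∈ K^⊥`,
`⟨(f,g), (f_λ,g_λ)⟩ = F(λ)`, where `F` is the analytic extension of `f` to the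
disc, `F(λ) = ⟨f, s_λ⟩ = ∫ f(ζ)/(1 - λ conj(ζ)) dm(ζ)`.

The direct sum `H² ⊕ L²(E)` is flattened into pairs, with inner products
(linear in the first slot, as in the paper) written out as integrals.
-/

open MeasureTheory Complex Metric Filter Set
open scoped Real ENNReal Topology ComplexConjugate

noncomputable section

instance fact_two_pi : Fact (0 < 2 * Real.pi) := ⟨by positivity⟩

abbrev CircT := AddCircle (2 * Real.pi)
abbrev m : Measure CircT := AddCircle.haarAddCircle
abbrev L2 := Lp ℂ 2 m

/-- The point `e^{iθ}` of the unit circle in `ℂ` corresponding to `θ`. -/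
def pt (θ : CircT) : ℂ := (AddCircle.toCircle θ : ℂ)

/-- The Hardy space `H²`. -/
def H2 : Submodule ℂ L2 :=
  (Submodule.span ℂ (Set.range fun n : ℕ => fourierLp 2 (n : ℤ))).topologicalClosure

/-- `(f, g)` is a member of `K^⊥`, the orthogonal complement of
`K = {(b h, √(1-|b|²) h) : h ∈ H²}` inside `H² ⊕ L²(E)`:
`f ∈ H²`, `g` vanishes a.e. off `E = {|b| < 1}`, and `(f,g) ⟂ K`. -/
def MemKperp (b : CircT → ℂ) (f g : L2) : Prop :=
  f ∈ H2 ∧ (∀ᵐ θ ∂m, ¬ ‖b θ‖ < 1 → g θ = 0) ∧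
  ∀ h : L2, h ∈ H2 →
    (∫ θ, (starRingEnd ℂ) (b θ * h θ) * f θ ∂m)
      + (∫ θ, (starRingEnd ℂ) ((Real.sqrt (1 - ‖b θ‖^2) : ℂ) * h θ) * g θ ∂m) = 0

lemma norm_pt (θ : CircT) : ‖pt θ‖ = 1 := Circle.norm_coe _

lemma cont_pt : Continuous pt := by unfold pt; fun_prop

lemma fourier_pt (n : ℕ) (θ : CircT) : fourier (n : ℤ) θ = pt θ ^ n := by
  rw [fourier_apply, AddCircle.toCircle_zsmul, zpow_natCast]
  rfl

lemma conj_pt (θ : CircT) : conj (pt θ) = (pt θ)⁻¹ := by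
  rw [Complex.inv_def, Complex.normSq_eq_norm_sq, norm_pt]; simp

lemma pt_ne (θ : CircT) : pt θ ≠ 0 := by
  rw [← norm_pos_iff, norm_pt]; exact one_pos

lemma den_lower (lam z : ℂ) (hz : ‖z‖ ≤ 1) : 1 - ‖lam‖ ≤ ‖1 - lam * z‖ := by
  have h1 := norm_sub_norm_le (1:ℂ) (lam * z)
  rw [norm_mul, norm_one] at h1
  nlinarith [norm_nonneg lam, norm_nonneg z]

lemma den_ne (lam z : ℂ) (hl : ‖lam‖ < 1) (hz : ‖z‖ ≤ 1) : 1 - lam * z ≠ 0 := by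
  rw [← norm_pos_iff]; linarith [den_lower lam z hz]

lemma inv_bound (lam z : ℂ) (hl : ‖lam‖ < 1) (hz : ‖z‖ ≤ 1) :
    ‖(1 - lam * z)⁻¹‖ ≤ (1 - ‖lam‖)⁻¹ := by
  rw [norm_inv]
  exact inv_anti₀ (by linarith) (den_lower lam z hz)

lemma int_eq (G : ℂ → ℂ) : ∫ θ, G (pt θ) ∂m = Real.circleAverage G 0 1 := by
  rw [AddCircle.integral_haarAddCircle, ← AddCircle.intervalIntegral_preimage _ 0,
    Real.circleAverage]
  simp [pt, circleMap, AddCircle.toCircle_apply_mk, Circle.coe_exp]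

lemma cauchy_r (Φ : ℂ → ℂ) (hΦ : DiffContOnCl ℂ Φ (ball (0:ℂ) 1)) (lam : ℂ)
    (hlam : lam ∈ ball (0:ℂ) 1) :
    ∫ θ, Φ (pt θ) * (1 - lam * conj (pt θ))⁻¹ ∂m = Φ lam := by
  have h := DiffContOnCl.circleAverage_smul_div (f := Φ) (c := 0) (R := 1) (w := lam)
    (by simpa using hΦ) (by simpa using hlam)
  rw [← h, ← int_eq]
  congr 1; ext θ
  have hl : ‖lam‖ < 1 := by simpa using hlam
  have h1 := den_ne lam (conj (pt θ)) hl (by simp [norm_pt])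
  rw [conj_pt] at *
  have := pt_ne θ
  have h2 : pt θ - lam ≠ 0 := by
    intro h; apply h1; rw [sub_eq_zero] at h; rw [← h]; field_simp; simp
  simp only [smul_eq_mul, sub_zero]
  field_simp

lemma cauchy (Φ : ℂ → ℂ) (hΦ : DifferentiableOn ℂ Φ (ball (0:ℂ) 1)) (C : ℝ)
    (hC : ∀ z ∈ ball (0:ℂ) 1, ‖Φ z‖ ≤ C) (β : CircT → ℂ)
    (hβ : ∀ᵐ θ ∂m, Tendsto (fun r : ℝ => Φ ((r : ℂ) * pt θ)) (𝓝[<] (1:ℝ)) (𝓝 (β θ)))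
    (lam : ℂ) (hlam : lam ∈ ball (0:ℂ) 1) :
    ∫ θ, β θ * (1 - lam * conj (pt θ))⁻¹ ∂m = Φ lam := by
  have hl : ‖lam‖ < 1 := by simpa using hlam
  have hr : ∀ᶠ r : ℝ in 𝓝[<] (1:ℝ), 0 < r ∧ r < 1 := by
    have : Ioo (0:ℝ) 1 ∈ 𝓝[<] (1:ℝ) := Ioo_mem_nhdsLT one_pos
    exact this
  have hmem : ∀ r : ℝ, 0 < r ∧ r < 1 → ∀ z : ℂ, ‖z‖ ≤ 1 → (r:ℂ) * z ∈ ball (0:ℂ) 1 := by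
    intro r hr z hz
    simp only [mem_ball_zero_iff, norm_mul, Complex.norm_real, Real.norm_eq_abs, abs_of_pos hr.1]
    nlinarith [norm_nonneg z]
  have hdiff : ∀ r : ℝ, 0 < r ∧ r < 1 →
      DifferentiableOn ℂ (fun z => Φ ((r:ℂ) * z)) (closedBall (0:ℂ) 1) := by
    intro r hr
    exact hΦ.comp (by fun_prop) (fun z hz => hmem r hr z (by simpa using hz))
  have h1 : Tendsto (fun r : ℝ => ∫ θ, Φ ((r:ℂ) * pt θ) * (1 - lam * conj (pt θ))⁻¹ ∂m)
      (𝓝[<] (1:ℝ)) (𝓝 (∫ θ, β θ * (1 - lam * conj (pt θ))⁻¹ ∂m)) := by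
    refine tendsto_integral_filter_of_dominated_convergence (fun _ => C * (1 - ‖lam‖)⁻¹) ?_ ?_ ?_ ?_
    · filter_upwards [hr] with r hr
      apply Continuous.aestronglyMeasurable
      refine Continuous.mul ?_ ?_
      · exact (hdiff r hr).continuousOn.comp_continuous cont_pt (fun θ => by simp [norm_pt])
      · refine Continuous.inv₀ ?_ (fun θ => den_ne lam _ hl (by simp [norm_pt]))
        have := cont_pt
        fun_prop
    · filter_upwards [hr] with r hr
      refine Eventually.of_forall fun θ => ?_
      rw [norm_mul]
      have hb := hC _ (hmem r hr (pt θ) (norm_pt θ).le)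
      exact mul_le_mul hb (inv_bound lam _ hl (by simp [norm_pt])) (norm_nonneg _)
        ((norm_nonneg _).trans hb)
    · exact integrable_const _
    · filter_upwards [hβ] with θ hθ
      exact hθ.mul_const _
  have h2 : Tendsto (fun r : ℝ => ∫ θ, Φ ((r:ℂ) * pt θ) * (1 - lam * conj (pt θ))⁻¹ ∂m)
      (𝓝[<] (1:ℝ)) (𝓝 (Φ lam)) := by
    have hc : Tendsto (fun r : ℝ => Φ ((r:ℂ) * lam)) (𝓝[<] (1:ℝ)) (𝓝 (Φ lam)) := by
      have hca : ContinuousAt Φ lam :=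
        (hΦ.differentiableAt (isOpen_ball.mem_nhds hlam)).continuousAt
      have : Tendsto (fun r : ℝ => (r:ℂ) * lam) (𝓝[<] (1:ℝ)) (𝓝 lam) := by
        have hcc : Continuous (fun r : ℝ => (r:ℂ) * lam) := by fun_prop
        have := hcc.tendsto 1
        simp only [ofReal_one, one_mul] at this
        exact this.mono_left nhdsWithin_le_nhds
      exact hca.tendsto.comp this
    refine hc.congr' ?_
    filter_upwards [hr] with r hr
    exact (cauchy_r (fun z => Φ ((r:ℂ) * z))
      ((hdiff r hr).mono closure_ball_subset_closedBall).diffContOnCl lam hlam).symm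
  exact tendsto_nhds_unique h1 h2

lemma mem_H2 (f : L2) (hf : ∀ k : ℕ, 1 ≤ k → ∫ θ, f θ * pt θ ^ k ∂m = 0) : f ∈ H2 := by
  have hs := hasSum_fourier_series_L2 f
  refine IsClosed.mem_of_tendsto (Submodule.isClosed_topologicalClosure _) hs ?_
  refine Eventually.of_forall fun s => ?_
  refine Submodule.sum_mem _ fun i _ => ?_
  rcases le_or_gt 0 i with hi | hi
  · obtain ⟨n, rfl⟩ := Int.eq_ofNat_of_zero_le hi
    exact Submodule.smul_mem _ _ (Submodule.le_topologicalClosure _ (Submodule.subset_span ⟨n, rfl⟩))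
  · obtain ⟨k, hk⟩ := Int.eq_ofNat_of_zero_le (show 0 ≤ -i by omega)
    have : fourierCoeff f i = 0 := by
      rw [fourierCoeff, ← hf k (by omega)]
      congr 1; ext θ
      rw [hk, fourier_pt, smul_eq_mul, mul_comm]
    rw [this, zero_smul]
    exact Submodule.zero_mem _

/-- If Φ = bounded analytic with boundary function f then f ∈ H2. -/
lemma mem_H2_of (Φ : ℂ → ℂ) (hΦ : DifferentiableOn ℂ Φ (ball (0:ℂ) 1)) (C : ℝ)
    (hC : ∀ z ∈ ball (0:ℂ) 1, ‖Φ z‖ ≤ C) (f : L2)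
    (hβ : ∀ᵐ θ ∂m, Tendsto (fun r : ℝ => Φ ((r : ℂ) * pt θ)) (𝓝[<] (1:ℝ)) (𝓝 (f θ))) :
    f ∈ H2 := by
  apply mem_H2
  intro k hk
  have := cauchy (fun z => Φ z * z ^ k) (hΦ.mul (by fun_prop)) C ?_ (fun θ => f θ * pt θ ^ k) ?_
    0 (by simp)
  · simpa [show k ≠ 0 by omega] using this
  · intro z hz
    have hz' : ‖z‖ < 1 := by simpa using hz
    rw [norm_mul, norm_pow]
    have := hC z hz
    have h2 : ‖z‖ ^ k ≤ 1 := pow_le_one₀ (norm_nonneg _) hz'.le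
    nlinarith [norm_nonneg (Φ z)]
  · filter_upwards [hβ] with θ hθ
    refine hθ.mul ?_
    have hcc : Continuous (fun r : ℝ => ((r:ℂ) * pt θ) ^ k) := by fun_prop
    have := hcc.tendsto 1
    simp only [ofReal_one, one_mul] at this
    exact this.mono_left nhdsWithin_le_nhds

lemma ortho (w : L2) (hw : ∀ n : ℕ, ∫ θ, conj (pt θ ^ n) * w θ ∂m = 0) (h : L2) (hh : h ∈ H2) :
    ∫ θ, conj (h θ) * w θ ∂m = 0 := by
  have key : H2 ≤ (Submodule.span ℂ {w})ᗮ := by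
    refine Submodule.topologicalClosure_minimal _ ?_ (Submodule.isClosed_orthogonal _)
    rw [Submodule.span_le]
    rintro _ ⟨n, rfl⟩
    rw [SetLike.mem_coe, Submodule.mem_orthogonal_singleton_iff_inner_left, L2.inner_def, ← hw n]
    apply integral_congr_ae
    filter_upwards [coeFn_fourierLp (T := 2 * Real.pi) 2 (n:ℤ)] with θ ht
    rw [ht, fourier_pt, RCLike.inner_apply']
  have := key hh
  rw [Submodule.mem_orthogonal_singleton_iff_inner_left, L2.inner_def] at this
  simpa only [RCLike.inner_apply'] using this

lemma intg (u : CircT → ℂ) (hu : AEStronglyMeasurable u m) (C : ℝ) (hC : ∀ᵐ θ ∂m, ‖u θ‖ ≤ C)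
    (F G : L2) : Integrable (fun θ => u θ * (conj (F θ) * G θ)) m := by
  refine Integrable.bdd_mul (c := C) ?_ hu hC
  have := L2.integrable_inner (𝕜 := ℂ) F G
  simpa only [RCLike.inner_apply'] using this

lemma tend_of_cont (P : ℂ → ℂ) (z : ℂ) (hP : ContinuousAt P z) :
    Tendsto (fun r : ℝ => P ((r : ℂ) * z)) (𝓝[<] (1:ℝ)) (𝓝 (P z)) := by
  have hcc : Continuous (fun r : ℝ => (r:ℂ) * z) := by fun_prop
  have := hcc.tendsto 1
  simp only [ofReal_one, one_mul] at this
  exact hP.tendsto.comp (this.mono_left nhdsWithin_le_nhds)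

/-- **`(f_λ, g_λ)` lies in `K^⊥` and reproduces the value at `λ` of the
analytic extension of the first coordinate of any element of `K^⊥`.** -/
theorem kernel_pair_in_Kperp_and_reproducing
    -- `b` as an analytic function `B` on the unit disc, bounded by `1`:
    (B : ℂ → ℂ) (hBan : DifferentiableOn ℂ B (ball (0:ℂ) 1))
    (hB1 : ∀ z ∈ ball (0:ℂ) 1, ‖B z‖ ≤ 1)
    -- its boundary function `b` on the circle (radial limits a.e.):
    (b : CircT → ℂ) (hbm : Measurable b)
    (hbdry : ∀ᵐ θ ∂m,
      Tendsto (fun r : ℝ => B ((r : ℂ) * pt θ)) (𝓝[<] (1:ℝ)) (𝓝 (b θ)))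
    -- a point `λ` of the open unit disc:
    (lam : ℂ) (hlam : lam ∈ ball (0:ℂ) 1)
    -- the pair `(f_λ, g_λ)` as elements of `L²`:
    (flam glam : L2)
    (hflam : ∀ᵐ θ ∂m, flam θ
      = (1 - (starRingEnd ℂ) (B lam) * b θ) / (1 - (starRingEnd ℂ) lam * pt θ))
    (hglam : ∀ᵐ θ ∂m, glam θ
      = -((starRingEnd ℂ) (B lam) * (Real.sqrt (1 - ‖b θ‖^2) : ℂ))
          / (1 - (starRingEnd ℂ) lam * pt θ)) :
    -- (1) `(f_λ, g_λ) ∈ K^⊥` (in particular `f_λ ∈ H²`, `g_λ ∈ L²(E)`):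
    MemKperp b flam glam
    -- (2) the reproducing property: for `(f, g) ∈ K^⊥`,
    --     `⟨(f,g), (f_λ,g_λ)⟩ = F(λ) = ⟨f, s_λ⟩`:
    ∧ ∀ f g : L2, MemKperp b f g →
        (∫ θ, (starRingEnd ℂ) (flam θ) * f θ ∂m)
          + (∫ θ, (starRingEnd ℂ) (glam θ) * g θ ∂m)
        = ∫ θ, f θ * (1 - lam * (starRingEnd ℂ) (pt θ))⁻¹ ∂m := by
  have hl : ‖lam‖ < 1 := by simpa using hlam
  have hl' : ‖conj lam‖ < 1 := by simpa using hl
  have hBl : ‖B lam‖ ≤ 1 := hB1 lam hlam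
  have hb1 : ∀ᵐ θ ∂m, ‖b θ‖ ≤ 1 := by
    filter_upwards [hbdry] with θ hθ
    refine le_of_tendsto hθ.norm ?_
    filter_upwards [Ioo_mem_nhdsLT (zero_lt_one (α := ℝ))] with r hr
    apply hB1
    simp [norm_pt, abs_of_pos hr.1, hr.2]
  have hptc := cont_pt
  -- the Szego kernel
  set s : CircT → ℂ := fun θ => (1 - conj lam * pt θ)⁻¹ with hs
  have hsc : Continuous s :=
    Continuous.inv₀ (by fun_prop) (fun θ => den_ne _ _ hl' (norm_pt θ).le)
  have hsb : ∀ θ, ‖s θ‖ ≤ (1 - ‖lam‖)⁻¹ := fun θ => by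
    have := inv_bound (conj lam) (pt θ) hl' (norm_pt θ).le
    rwa [RCLike.norm_conj] at this
  have hst : ∀ θ, conj (s θ) = (1 - lam * conj (pt θ))⁻¹ := fun θ => by simp [hs]
  have hsP : ∀ θ, ContinuousAt (fun z : ℂ => (1 - conj lam * z)⁻¹) (pt θ) := fun θ =>
    ContinuousAt.inv₀ (by fun_prop) (den_ne _ _ hl' (norm_pt θ).le)
  have hsd : DifferentiableOn ℂ (fun z : ℂ => (1 - conj lam * z)⁻¹) (ball (0:ℂ) 1) := by
    refine DifferentiableOn.inv (by fun_prop) fun z hz => den_ne _ _ hl' ?_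
    have : ‖z‖ < 1 := by simpa using hz
    exact this.le
  have hsB : ∀ z ∈ ball (0:ℂ) 1, ‖(1 - conj lam * z)⁻¹‖ ≤ (1 - ‖lam‖)⁻¹ := fun z hz => by
    have : ‖z‖ < 1 := by simpa using hz
    simpa using inv_bound (conj lam) z hl' this.le
  have hsL : MemLp s 2 m := MemLp.of_bound hsc.aestronglyMeasurable _ (Eventually.of_forall hsb)
  have hSae : hsL.toLp s =ᵐ[m] s := hsL.coeFn_toLp
  have hSH : hsL.toLp s ∈ H2 := by
    refine mem_H2_of _ hsd _ hsB _ ?_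
    filter_upwards [hSae] with θ hθ
    rw [hθ]
    exact tend_of_cont _ _ (hsP θ)
  have hbs : AEStronglyMeasurable b m := hbm.aestronglyMeasurable
  have hbc : AEStronglyMeasurable (fun θ => conj (b θ)) m :=
    (Complex.continuous_conj.measurable.comp hbm).aestronglyMeasurable
  have hqm : Measurable (fun θ => ((Real.sqrt (1 - ‖b θ‖^2) : ℝ) : ℂ)) := by fun_prop
  have hqb : ∀ᵐ θ ∂m, ‖((Real.sqrt (1 - ‖b θ‖^2) : ℝ) : ℂ)‖ ≤ 1 := by
    refine Eventually.of_forall fun θ => ?_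
    rw [Complex.norm_real, Real.norm_eq_abs, abs_of_nonneg (Real.sqrt_nonneg _)]
    rw [Real.sqrt_le_iff]
    refine ⟨zero_le_one, ?_⟩
    nlinarith [norm_nonneg (b θ)]
  have hbcb : ∀ᵐ θ ∂m, ‖conj (b θ)‖ ≤ 1 := by
    filter_upwards [hb1] with θ h; simpa using h
  refine ⟨⟨?_, ?_, ?_⟩, ?_⟩
  · refine mem_H2_of (fun z => (1 - conj (B lam) * B z) * (1 - conj lam * z)⁻¹)
      (DifferentiableOn.mul (by fun_prop) hsd) (2 * (1 - ‖lam‖)⁻¹) ?_ _ ?_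
    · intro z hz
      rw [norm_mul]
      refine mul_le_mul ?_ (hsB z hz) (norm_nonneg _) (by norm_num)
      refine (norm_sub_le _ _).trans ?_
      rw [norm_mul, norm_one, RCLike.norm_conj]
      nlinarith [hB1 z hz, norm_nonneg (B z), norm_nonneg (B lam)]
    · filter_upwards [hflam, hbdry] with θ h1 h2
      rw [h1, div_eq_mul_inv]
      exact (tendsto_const_nhds.sub (h2.const_mul _)).mul (tend_of_cont _ _ (hsP θ))
  · filter_upwards [hglam] with θ h1 h2
    rw [h1, Real.sqrt_eq_zero_of_nonpos (by nlinarith [not_lt.mp h2])]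
    simp
  · intro h hh
    have hwm : AEStronglyMeasurable (fun θ => (conj (b θ) - conj (B lam)) * s θ) m :=
      (hbc.sub aestronglyMeasurable_const).mul hsc.aestronglyMeasurable
    have hwL : MemLp (fun θ => (conj (b θ) - conj (B lam)) * s θ) 2 m := by
      refine MemLp.of_bound hwm (2 * (1 - ‖lam‖)⁻¹) ?_
      filter_upwards [hb1] with θ h1
      rw [norm_mul]
      refine mul_le_mul ?_ (hsb θ) (norm_nonneg _) (by norm_num)
      refine (norm_sub_le _ _).trans ?_
      rw [RCLike.norm_conj, RCLike.norm_conj]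
      linarith
    have hwae := hwL.coeFn_toLp
    have h0 := ortho (hwL.toLp _) (fun n => by
      have hc := cauchy (fun z => z ^ n * (B z - B lam)) (by fun_prop) 2 (by
        intro z hz
        have hz' : ‖z‖ < 1 := by simpa using hz
        rw [norm_mul, norm_pow]
        have h2 : ‖z‖ ^ n ≤ 1 := pow_le_one₀ (norm_nonneg _) hz'.le
        have h3 : ‖B z - B lam‖ ≤ 2 := by
          refine (norm_sub_le _ _).trans ?_
          linarith [hB1 z hz]
        nlinarith [norm_nonneg (B z - B lam)]) (fun θ => pt θ ^ n * (b θ - B lam)) (by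
        filter_upwards [hbdry] with θ h2
        exact (tend_of_cont (fun z => z ^ n) _ (by fun_prop)).mul (h2.sub_const _)) lam hlam
      simp only [sub_self, mul_zero] at hc
      have hc' := congrArg conj hc
      rw [map_zero, ← integral_conj] at hc'
      rw [← hc']
      apply integral_congr_ae
      filter_upwards [hwae] with θ h1
      rw [h1, ← hst]
      simp only [map_mul, map_sub, Complex.conj_conj, map_pow]
      ring) h hh
    rw [← h0, ← integral_add]
    · apply integral_congr_ae
      filter_upwards [hwae, hflam, hglam, hb1] with θ h1 h2 h3 h4
      simp only [h1, h2, h3, div_eq_mul_inv]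
      change _ * (_ * s θ) + _ * (_ * s θ) = _
      have hq : ((Real.sqrt (1 - ‖b θ‖^2) : ℝ) : ℂ) * ((Real.sqrt (1 - ‖b θ‖^2) : ℝ) : ℂ)
          = 1 - conj (b θ) * b θ := by
        rw [← Complex.ofReal_mul, Real.mul_self_sqrt (by nlinarith [norm_nonneg (b θ)]),
          Complex.conj_mul']
        push_cast; rfl
      simp only [map_mul, Complex.conj_ofReal]
      linear_combination (-conj (h θ) * conj (B lam) * s θ) * hq
    · refine (intg _ hbc 1 hbcb h flam).congr (Eventually.of_forall fun θ => ?_)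
      simp only [map_mul]; ring
    · refine (intg _ hqm.aestronglyMeasurable 1 hqb h glam).congr (Eventually.of_forall fun θ => ?_)
      simp only [map_mul, Complex.conj_ofReal]; ring
  · intro f g hfg
    have h0 := hfg.2.2 _ hSH
    have e1 : ∫ θ, conj (flam θ) * f θ ∂m
        = (∫ θ, f θ * (1 - lam * conj (pt θ))⁻¹ ∂m)
          - B lam * ∫ θ, conj (b θ * hsL.toLp s θ) * f θ ∂m := by
      rw [← integral_const_mul, ← integral_sub]
      · apply integral_congr_ae
        filter_upwards [hflam, hSae] with θ h1 h2
        rw [h1, h2, div_eq_mul_inv, ← hst]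
        change conj (_ * s θ) * _ = _
        simp only [map_mul, map_sub, map_one, Complex.conj_conj]
        ring
      · refine (intg (fun _ => 1) aestronglyMeasurable_const 1 (by simp) (hsL.toLp s) f).congr ?_
        filter_upwards [hSae] with θ h2
        rw [h2, ← hst]; ring
      · refine Integrable.const_mul ?_ _
        refine (intg _ hbc 1 hbcb (hsL.toLp s) f).congr (Eventually.of_forall fun θ => ?_)
        simp only [map_mul]; ring
    have e2 : ∫ θ, conj (glam θ) * g θ ∂m
        = - (B lam * ∫ θ, conj ((Real.sqrt (1 - ‖b θ‖^2) : ℂ) * hsL.toLp s θ) * g θ ∂m) := by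
      rw [← integral_const_mul, ← integral_neg]
      apply integral_congr_ae
      filter_upwards [hglam, hSae] with θ h1 h2
      rw [h1, h2, div_eq_mul_inv]
      change conj (_ * s θ) * _ = _
      simp only [map_mul, map_neg, Complex.conj_conj]
      ring
    rw [e1, e2]
    linear_combination (-B lam) * h0
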